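/- (Mode-reduced commutation identity for W, eq. (9)–(10).) There exist a constant Ĉ > 0 and smooth functions h₁, h₂, h₃ : (2M,∞) → ℝ, all depending only on M and s (in particular independent of ℓ, ε, β and ψ), with sup_{r>2M} ( r²|h₁(r)| + r²|h₂(r)| + r³|h₃(r)| ) ≤ Ĉ, such that for every integer ℓ ≥ s, every ε ≥ 0, every pair β^t, β^r satisfying the stated bounds, and every smooth solution ψ of P_{s,ℓ}ψ = ε(β^t ∂_t ψ + β^r ∂_r ψ) on ℝ × (2M,∞), the following identity holds: P_{s,ℓ}(Wψ) = −(2/r)(1+6M/r)^{−1/2} D^{−1} ∂_t(Wψ) + ε r^{−2} W[ r² (β^t ∂_t ψ + β^r ∂_r ψ) ] + D^{−1/2} ( h₁ ∂_r ψ + h₂ ∂_t ψ + h₃ ψ ). -/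

import Mathlib

open MeasureTheory Set
open scoped ENNReal

noncomputable section

/-- `D(r) = 1 - 2M/r`. -/
def Dc (M r : ℝ) : ℝ := 1 - 2*M/r

/-- `f(r) = (1 - 3M/r) √(1 + 6M/r)`. -/
def fc (M r : ℝ) : ℝ := (1 - 3*M/r) * Real.sqrt (1 + 6*M/r)

/-- Partial derivative in `t`. -/
def pt (ψ : ℝ → ℝ → ℝ) : ℝ → ℝ → ℝ := fun t r => deriv (fun t' => ψ t' r) t

/-- Partial derivative in `r`. -/
def pr (ψ : ℝ → ℝ → ℝ) : ℝ → ℝ → ℝ := fun t r => deriv (fun r' => ψ t r') r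

/-- `R* = (2M/r) ∂_t + D ∂_r`. -/
def Rst (M : ℝ) (ψ : ℝ → ℝ → ℝ) : ℝ → ℝ → ℝ :=
  fun t r => (2*M/r) * pt ψ t r + Dc M r * pr ψ t r

/-- `W = (r/√D)(R* + f T)`. -/
def Wc (M : ℝ) (ψ : ℝ → ℝ → ℝ) : ℝ → ℝ → ℝ :=
  fun t r => (r / Real.sqrt (Dc M r)) * (Rst M ψ t r + fc M r * pt ψ t r)

/-- The mode-reduced Regge--Wheeler operator `P_{s,ℓ}`. -/
def Pc (M : ℝ) (s ℓ : ℕ) (ψ : ℝ → ℝ → ℝ) : ℝ → ℝ → ℝ := fun t r =>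
  (1 + 2*M/r) * pt (pt ψ) t r - (4*M/r) * pt (pr ψ) t r + (2*M/r^2) * pt ψ t r
    - pr (fun t' r' => Dc M r' * pr ψ t' r') t r
    + ((ℓ : ℝ)*((ℓ : ℝ)+1)/r^2) * ψ t r + (1 - (s : ℝ)^2) * (2*M/r^3) * ψ t r

/-- Slice energy `E[ψ](τ)` (degenerate at the horizon). -/
def eE (M : ℝ) (ℓ : ℕ) (ψ : ℝ → ℝ → ℝ) (τ : ℝ) : ℝ≥0∞ :=
  ∫⁻ r in Ioi (2*M), ENNReal.ofReal
    ((pt ψ τ r)^2 + Dc M r * (pr ψ τ r)^2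
      + (ℓ : ℝ)*((ℓ : ℝ)+1)*(ψ τ r)^2/r^2 + (ψ τ r)^2/r^2)

/-- Non-degenerate slice energy `Ē[ψ](τ)`. -/
def eEbar (M : ℝ) (ℓ : ℕ) (ψ : ℝ → ℝ → ℝ) (τ : ℝ) : ℝ≥0∞ :=
  ∫⁻ r in Ioi (2*M), ENNReal.ofReal
    ((pt ψ τ r)^2 + (pr ψ τ r)^2
      + (ℓ : ℝ)*((ℓ : ℝ)+1)*(ψ τ r)^2/r^2 + (ψ τ r)^2/r^2)

/-- Spacetime energy `I_ndeg[ψ](τ₁,τ₂)` (degenerate at the horizon). -/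
def iNdeg (M : ℝ) (ℓ : ℕ) (ψ : ℝ → ℝ → ℝ) (τ₁ τ₂ : ℝ) : ℝ≥0∞ :=
  ∫⁻ τ in Ioc τ₁ τ₂, ∫⁻ r in Ioi (2*M), ENNReal.ofReal
    ((pt ψ τ r)^2/r^2 + Dc M r * (pr ψ τ r)^2/r^2
      + (ℓ : ℝ)*((ℓ : ℝ)+1)*(ψ τ r)^2/r^3 + (ψ τ r)^2/r^3)

/-- Non-degenerate spacetime energy `Ī_ndeg[ψ](τ₁,τ₂)`. -/
def iNdegBar (M : ℝ) (ℓ : ℕ) (ψ : ℝ → ℝ → ℝ) (τ₁ τ₂ : ℝ) : ℝ≥0∞ :=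
  ∫⁻ τ in Ioc τ₁ τ₂, ∫⁻ r in Ioi (2*M), ENNReal.ofReal
    ((pt ψ τ r)^2/r^2 + (pr ψ τ r)^2/r^2
      + (ℓ : ℝ)*((ℓ : ℝ)+1)*(ψ τ r)^2/r^3 + (ψ τ r)^2/r^3)

/-- Spacetime energy `Ī_deg[ψ](τ₁,τ₂)` degenerating at the photon sphere `r = 3M`. -/
def iDegBar (M : ℝ) (ℓ : ℕ) (ψ : ℝ → ℝ → ℝ) (τ₁ τ₂ : ℝ) : ℝ≥0∞ :=
  ∫⁻ τ in Ioc τ₁ τ₂, ∫⁻ r in Ioi (2*M), ENNReal.ofReal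
    ((1 - 3*M/r)^2 * ((pt ψ τ r)^2/r^2 + (pr ψ τ r)^2/r^2
        + (ℓ : ℝ)*((ℓ : ℝ)+1)*(ψ τ r)^2/r^3)
      + (Rst M ψ τ r)^2/r^2 + (ψ τ r)^2/r^3)

/-- Smoothness of a two-variable function on `ℝ × S`. -/
def SmoothOnRegion (ψ : ℝ → ℝ → ℝ) (S : Set ℝ) : Prop :=
  ContDiffOn ℝ (⊤ : ℕ∞) (Function.uncurry ψ) (univ ×ˢ S)

/-- Compact support in `r` on every compact time interval. -/
def CompactRSupport (ψ : ℝ → ℝ → ℝ) : Prop :=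
  ∀ a b : ℝ, ∃ R : ℝ, ∀ t r : ℝ, t ∈ Icc a b → R ≤ r → ψ t r = 0

/-- The pointwise bounds (5) on the perturbation `β = (β^t, β^r)`. -/
def BetaBounds (M C : ℝ) (βt βr : ℝ → ℝ → ℝ) : Prop :=
  ∀ t r : ℝ, 2*M < r →
    r^2 * |βt t r| + r^2 * |βr t r|
      + r ^ ((3:ℝ)/2) * |Wc M βt t r| + r ^ ((3:ℝ)/2) * |Wc M βr t r| ≤ C

/-- `ψ` solves the mode-reduced perturbed Regge--Wheeler equation. -/
def SolvesPerturbedRW (M : ℝ) (s ℓ : ℕ) (ε : ℝ) (βt βr ψ : ℝ → ℝ → ℝ) : Prop :=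
  ∀ t r : ℝ, 2*M < r →
    Pc M s ℓ ψ t r = ε * (βt t r * pt ψ t r + βr t r * pr ψ t r)

section PartialDerivatives

variable {u v : ℝ → ℝ → ℝ} {a t r : ℝ}

lemma SmoothOnRegion.contDiffAt (hu : SmoothOnRegion u (Ioi a)) (hr : a < r) :
    ContDiffAt ℝ (⊤ : ℕ∞) (Function.uncurry u) (t, r) :=
  ContDiffOn.contDiffAt hu ((isOpen_univ.prod isOpen_Ioi).mem_nhds (mk_mem_prod (mem_univ t) hr))

lemma SmoothOnRegion.hasFDerivAt (hu : SmoothOnRegion u (Ioi a)) (hr : a < r) :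
    HasFDerivAt (Function.uncurry u) (fderiv ℝ (Function.uncurry u) (t, r)) (t, r) :=
  ((hu.contDiffAt hr).differentiableAt (by simp)).hasFDerivAt

lemma SmoothOnRegion.pt_eq_fderiv (hu : SmoothOnRegion u (Ioi a)) (hr : a < r) :
    pt u t r = fderiv ℝ (Function.uncurry u) (t, r) (1, 0) :=
  (HasFDerivAt.comp_hasDerivAt (f := fun t' => (t', r)) t (hu.hasFDerivAt hr)
    ((hasDerivAt_id t).prodMk (hasDerivAt_const t r))).deriv

lemma SmoothOnRegion.pr_eq_fderiv (hu : SmoothOnRegion u (Ioi a)) (hr : a < r) :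
    pr u t r = fderiv ℝ (Function.uncurry u) (t, r) (0, 1) :=
  (HasFDerivAt.comp_hasDerivAt (f := fun r' => (t, r')) r (hu.hasFDerivAt hr)
    ((hasDerivAt_const r t).prodMk (hasDerivAt_id r))).deriv

lemma SmoothOnRegion.hasDerivAt_pt (hu : SmoothOnRegion u (Ioi a)) (hr : a < r) :
    HasDerivAt (fun t' => u t' r) (pt u t r) t :=
  (HasFDerivAt.comp_hasDerivAt (f := fun t' => (t', r)) t (hu.hasFDerivAt hr)
    ((hasDerivAt_id t).prodMk (hasDerivAt_const t r))).differentiableAt.hasDerivAt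

lemma SmoothOnRegion.hasDerivAt_pr (hu : SmoothOnRegion u (Ioi a)) (hr : a < r) :
    HasDerivAt (fun r' => u t r') (pr u t r) r :=
  (HasFDerivAt.comp_hasDerivAt (f := fun r' => (t, r')) r (hu.hasFDerivAt hr)
    ((hasDerivAt_const r t).prodMk (hasDerivAt_id r))).differentiableAt.hasDerivAt

lemma SmoothOnRegion.fderiv_apply (hu : SmoothOnRegion u (Ioi a)) (e : ℝ × ℝ) :
    ContDiffOn ℝ (⊤ : ℕ∞) (fun p => fderiv ℝ (Function.uncurry u) p e) (univ ×ˢ Ioi a) :=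
  (ContDiffOn.fderiv_of_isOpen hu (isOpen_univ.prod isOpen_Ioi) (by simp)).clm_apply
    contDiffOn_const

lemma SmoothOnRegion.partial_t (hu : SmoothOnRegion u (Ioi a)) : SmoothOnRegion (pt u) (Ioi a) :=
  (hu.fderiv_apply (1, 0)).congr fun _ hp => hu.pt_eq_fderiv hp.2

lemma SmoothOnRegion.partial_r (hu : SmoothOnRegion u (Ioi a)) : SmoothOnRegion (pr u) (Ioi a) :=
  (hu.fderiv_apply (0, 1)).congr fun _ hp => hu.pr_eq_fderiv hp.2

lemma pt_congr (h : ∀ t, u t r = v t r) : pt u t r = pt v t r := by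
  simp only [pt, h]

lemma pr_congr (h : ∀ r, a < r → u t r = v t r) (hr : a < r) : pr u t r = pr v t r :=
  Filter.EventuallyEq.deriv_eq (Filter.mem_of_superset (Ioi_mem_nhds hr) h)

lemma SmoothOnRegion.pr_pt (hu : SmoothOnRegion u (Ioi a)) (hr : a < r) :
    pr (pt u) t r = pt (pr u) t r := by
  have hsymm : IsSymmSndFDerivAt ℝ (Function.uncurry u) (t, r) :=
    (hu.contDiffAt hr).isSymmSndFDerivAt (by simp; exact WithTop.coe_le_coe.2 (le_top (a := (2 : ℕ∞))))
  have hd : DifferentiableAt ℝ (fderiv ℝ (Function.uncurry u)) (t, r) :=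
    ((hu.contDiffAt hr).fderiv_right (m := (⊤ : ℕ∞)) (by simp)).differentiableAt (by simp)
  have h1 : pr (pt u) t r =
      fderiv ℝ (fderiv ℝ (Function.uncurry u)) (t, r) (0, 1) (1, 0) := by
    rw [pr_congr (v := fun t r => fderiv ℝ (Function.uncurry u) (t, r) (1, 0))
      (fun r' h => hu.pt_eq_fderiv h) hr]
    have := HasFDerivAt.comp_hasDerivAt (f := fun r' => (t, r')) r hd.hasFDerivAt
      ((hasDerivAt_const r t).prodMk (hasDerivAt_id r))
    exact (((ContinuousLinearMap.apply ℝ ℝ ((1, 0) : ℝ × ℝ)).hasFDerivAt).comp_hasDerivAt r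
      this).deriv
  have h2 : pt (pr u) t r =
      fderiv ℝ (fderiv ℝ (Function.uncurry u)) (t, r) (1, 0) (0, 1) := by
    rw [pt_congr (v := fun t r => fderiv ℝ (Function.uncurry u) (t, r) (0, 1))
      (fun t' => hu.pr_eq_fderiv hr)]
    have := HasFDerivAt.comp_hasDerivAt (f := fun t' => (t', r)) t hd.hasFDerivAt
      ((hasDerivAt_id t).prodMk (hasDerivAt_const t r))
    exact (((ContinuousLinearMap.apply ℝ ℝ ((0, 1) : ℝ × ℝ)).hasFDerivAt).comp_hasDerivAt t
      this).deriv
  rw [h1, h2, hsymm.eq]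

end PartialDerivatives

section Coefficients

variable {M r : ℝ}

lemma Dc_pos (hM : 0 < M) (hr : 2 * M < r) : 0 < Dc M r := by
  have h0 : 0 < r := by linarith
  rw [Dc, sub_pos, div_lt_one h0]
  exact hr

/-- The `∂_t`-coefficient of `W`. -/
def wCoeffT (M r : ℝ) : ℝ :=
  (2 * M + (r - 3 * M) * Real.sqrt (1 + 6 * M / r)) / Real.sqrt (Dc M r)

/-- The `∂_r`-coefficient of `W`. -/
def wCoeffR (M r : ℝ) : ℝ := r * Real.sqrt (Dc M r)

/-- `D` times the derivative of `wCoeffT`. -/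
def wFluxT (M r : ℝ) : ℝ :=
  ((Real.sqrt (1 + 6 * M / r))⁻¹ - 2 * M ^ 2 / r ^ 2) / Real.sqrt (Dc M r)

/-- `D` times the derivative of `wCoeffR`. -/
def wFluxR (M r : ℝ) : ℝ := Real.sqrt (Dc M r) * (1 - M / r)

/-- The coefficient `h₁` of the commutator. -/
def remainderR (M r : ℝ) : ℝ := -(M * (2 - 3 * M / r) / r ^ 2)

/-- The coefficient `h₂` of the commutator. -/
def remainderT (M r : ℝ) : ℝ :=
  M / r ^ 2 * (((Real.sqrt (1 + 6 * M / r))⁻¹ - 2 * (M / r) ^ 2) / Dc M r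
    - 3 * (Real.sqrt (1 + 6 * M / r))⁻¹ ^ 3 - 4 * (M / r))

/-- The coefficient `h₃` of the commutator. -/
def remainderZ (M : ℝ) (s : ℕ) (r : ℝ) : ℝ := Dc M r * (1 - (s : ℝ) ^ 2) * (2 * M) / r ^ 3

lemma Wc_eq (hM : 0 < M) (hr : 2 * M < r) (u : ℝ → ℝ → ℝ) (t : ℝ) :
    Wc M u t r = wCoeffT M r * pt u t r + wCoeffR M r * pr u t r := by
  have h0 : 0 < r := by linarith
  have hD := Dc_pos hM hr
  have hg := Real.sqrt_pos.2 hD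
  have hgg := Real.mul_self_sqrt hD.le
  simp only [Wc, Rst, fc, wCoeffT, wCoeffR]
  generalize Real.sqrt (Dc M r) = g at *
  rw [← hgg]
  field_simp
  ring

lemma hasDerivAt_Dc (h0 : 0 < r) : HasDerivAt (Dc M) (2 * M / r ^ 2) r := by
  have := ((hasDerivAt_const r (2 * M)).div (hasDerivAt_id r) h0.ne').const_sub 1
  refine this.congr_deriv ?_
  simp
  ring

lemma hasDerivAt_sqrt_Dc (hM : 0 < M) (hr : 2 * M < r) :
    HasDerivAt (fun r => Real.sqrt (Dc M r)) (M / (r ^ 2 * Real.sqrt (Dc M r))) r := by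
  have h0 : 0 < r := by linarith
  refine ((hasDerivAt_Dc h0).sqrt (Dc_pos hM hr).ne').congr_deriv ?_
  have hg := Real.sqrt_pos.2 (Dc_pos hM hr)
  field_simp

lemma one_add_pos (hM : 0 < M) (h0 : 0 < r) : 0 < 1 + 6 * M / r := by positivity

lemma hasDerivAt_sqrt_one_add (hM : 0 < M) (h0 : 0 < r) :
    HasDerivAt (fun r => Real.sqrt (1 + 6 * M / r))
      (-(3 * M / (r ^ 2 * Real.sqrt (1 + 6 * M / r)))) r := by
  have h := ((hasDerivAt_const r (6 * M)).div (hasDerivAt_id r) h0.ne').const_add 1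
  refine (h.sqrt (one_add_pos hM h0).ne').congr_deriv ?_
  have hw := Real.sqrt_pos.2 (one_add_pos hM h0)
  simp
  field_simp
  ring

/-- The algebraic relations satisfied by `√D` and `√(1 + 6M/r)`. -/
lemma sqrt_relations (hM : 0 < M) (hr : 2 * M < r) :
    Real.sqrt (Dc M r) ^ 2 * r = r - 2 * M ∧ Real.sqrt (1 + 6 * M / r) ^ 2 * r = r + 6 * M ∧
      Dc M r = Real.sqrt (Dc M r) ^ 2 := by
  have h0 : 0 < r := by linarith
  rw [Real.sq_sqrt (Dc_pos hM hr).le, Real.sq_sqrt (one_add_pos hM h0).le, Dc]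
  refine ⟨?_, ?_, rfl⟩ <;> field_simp

lemma hasDerivAt_wCoeffT (hM : 0 < M) (hr : 2 * M < r) :
    HasDerivAt (wCoeffT M) (wFluxT M r / Dc M r) r := by
  have h0 : 0 < r := by linarith
  have hg := Real.sqrt_pos.2 (Dc_pos hM hr)
  have hw := Real.sqrt_pos.2 (one_add_pos hM h0)
  obtain ⟨h1, h2, h3⟩ := sqrt_relations hM hr
  refine ((((hasDerivAt_id r).sub_const (3 * M)).mul (hasDerivAt_sqrt_one_add hM h0)
    |>.const_add (2 * M)).div (hasDerivAt_sqrt_Dc hM hr) hg.ne').congr_deriv ?_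
  simp only [wFluxT, Pi.mul_apply, id]
  rw [h3, Real.sqrt_sq hg.le]
  generalize Real.sqrt (Dc M r) = g at *
  generalize Real.sqrt (1 + 6 * M / r) = w at *
  obtain rfl : M = r * (1 - g ^ 2) / 2 := by linarith
  have hw2 : w ^ 2 = 4 - 3 * g ^ 2 := by
    apply mul_right_cancel₀ h0.ne'; linarith
  clear h1 h2 h3 hM hr
  field_simp
  linear_combination (1 + 3 * g ^ 4) * hw2

lemma hasDerivAt_wCoeffR (hM : 0 < M) (hr : 2 * M < r) :
    HasDerivAt (wCoeffR M) (wFluxR M r / Dc M r) r := by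
  have h0 : 0 < r := by linarith
  have hg := Real.sqrt_pos.2 (Dc_pos hM hr)
  obtain ⟨h1, -, h3⟩ := sqrt_relations hM hr
  refine ((hasDerivAt_id r).mul (hasDerivAt_sqrt_Dc hM hr)).congr_deriv ?_
  simp only [wFluxR, id]
  rw [h3, Real.sqrt_sq hg.le]
  generalize Real.sqrt (Dc M r) = g at *
  obtain rfl : M = r * (1 - g ^ 2) / 2 := by linarith
  clear h1 h3 hM hr
  field_simp
  ring

lemma hasDerivAt_wFluxT (hM : 0 < M) (hr : 2 * M < r) :
    HasDerivAt (wFluxT M) (-((Real.sqrt (Dc M r))⁻¹ * remainderT M r)) r := by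
  have h0 : 0 < r := by linarith
  have hg := Real.sqrt_pos.2 (Dc_pos hM hr)
  have hw := Real.sqrt_pos.2 (one_add_pos hM h0)
  obtain ⟨h1, h2, h3⟩ := sqrt_relations hM hr
  refine ((((hasDerivAt_sqrt_one_add hM h0).inv hw.ne').sub
    ((hasDerivAt_const r (2 * M ^ 2)).div (hasDerivAt_pow 2 r) (by positivity))).div
      (hasDerivAt_sqrt_Dc hM hr) hg.ne').congr_deriv ?_
  simp only [remainderT, Pi.inv_apply, Pi.div_apply, Pi.sub_apply]
  rw [h3, Real.sqrt_sq hg.le]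
  generalize Real.sqrt (Dc M r) = g at *
  generalize Real.sqrt (1 + 6 * M / r) = w at *
  obtain rfl : M = r * (1 - g ^ 2) / 2 := by linarith
  have hw2 : w ^ 2 = 4 - 3 * g ^ 2 := by
    apply mul_right_cancel₀ h0.ne'; linarith
  clear h1 h2 h3 hM hr
  simp
  field_simp
  grind

lemma hasDerivAt_wFluxR (hM : 0 < M) (hr : 2 * M < r) :
    HasDerivAt (wFluxR M) (-((Real.sqrt (Dc M r))⁻¹ * remainderR M r)) r := by
  have h0 : 0 < r := by linarith
  have hg := Real.sqrt_pos.2 (Dc_pos hM hr)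
  obtain ⟨h1, -, h3⟩ := sqrt_relations hM hr
  refine ((hasDerivAt_sqrt_Dc hM hr).mul
    (((hasDerivAt_const r M).div (hasDerivAt_id r) h0.ne').const_sub 1)).congr_deriv ?_
  simp only [remainderR, id]
  generalize Real.sqrt (Dc M r) = g at *
  obtain rfl : M = r * (1 - g ^ 2) / 2 := by linarith
  clear h1 h3 hM hr
  simp
  field_simp
  ring

lemma commutator_coeff_tt (hM : 0 < M) (hr : 2 * M < r) :
    -(4 * M / r) * (wFluxT M r / Dc M r) - 2 * wCoeffR M r / r * (1 + 2 * M / r)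
      + wCoeffR M r * (2 * M / r ^ 2)
      + 2 / r * (Real.sqrt (1 + 6 * M / r))⁻¹ * (Dc M r)⁻¹ * wCoeffT M r = 0 := by
  have h0 : 0 < r := by linarith
  have hg := Real.sqrt_pos.2 (Dc_pos hM hr)
  have hw := Real.sqrt_pos.2 (one_add_pos hM h0)
  obtain ⟨h1, h2, h3⟩ := sqrt_relations hM hr
  simp only [wFluxT, wCoeffR, wCoeffT]
  rw [h3, Real.sqrt_sq hg.le]
  generalize Real.sqrt (Dc M r) = g at *
  generalize Real.sqrt (1 + 6 * M / r) = w at *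
  obtain rfl : M = r * (1 - g ^ 2) / 2 := by linarith
  have hw2 : w ^ 2 = 4 - 3 * g ^ 2 := by
    apply mul_right_cancel₀ h0.ne'; linarith
  clear h1 h2 h3 hM hr
  field_simp
  ring

lemma commutator_coeff_tr (hM : 0 < M) (hr : 2 * M < r) :
    -2 * wFluxT M r - 4 * M / r * (wFluxR M r / Dc M r) + 4 * M / r ^ 2 * wCoeffR M r
      + 2 / r * (Real.sqrt (1 + 6 * M / r))⁻¹ * (Dc M r)⁻¹ * wCoeffR M r = 0 := by
  have h0 : 0 < r := by linarith
  have hg := Real.sqrt_pos.2 (Dc_pos hM hr)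
  have hw := Real.sqrt_pos.2 (one_add_pos hM h0)
  obtain ⟨h1, h2, h3⟩ := sqrt_relations hM hr
  simp only [wFluxT, wCoeffR, wFluxR]
  rw [h3, Real.sqrt_sq hg.le]
  generalize Real.sqrt (Dc M r) = g at *
  generalize Real.sqrt (1 + 6 * M / r) = w at *
  obtain rfl : M = r * (1 - g ^ 2) / 2 := by linarith
  have hw2 : w ^ 2 = 4 - 3 * g ^ 2 := by
    apply mul_right_cancel₀ h0.ne'; linarith
  clear h1 h2 h3 hM hr
  field_simp
  ring

lemma commutator_coeff_rr (hM : 0 < M) (hr : 2 * M < r) :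
    -2 * wFluxR M r + 2 * wCoeffR M r / r * Dc M r + wCoeffR M r * (2 * M / r ^ 2) = 0 := by
  have h0 : 0 < r := by linarith
  have hg := Real.sqrt_pos.2 (Dc_pos hM hr)
  obtain ⟨h1, -, h3⟩ := sqrt_relations hM hr
  simp only [wCoeffR, wFluxR]
  rw [h3, Real.sqrt_sq hg.le]
  generalize Real.sqrt (Dc M r) = g at *
  obtain rfl : M = r * (1 - g ^ 2) / 2 := by linarith
  clear h1 h3 hM hr
  field_simp
  ring

lemma contDiffOn_Dc : ContDiffOn ℝ (⊤ : ℕ∞) (Dc M) {0}ᶜ :=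
  contDiffOn_const.sub (contDiffOn_const.div contDiffOn_id fun _ h => h)

lemma Ioi_subset_compl_zero (hM : 0 < M) : Ioi (2 * M) ⊆ {0}ᶜ := fun r hr => by
  have : 2 * M < r := hr
  simp only [mem_compl_iff, mem_singleton_iff]
  linarith

lemma contDiffOn_remainderR (hM : 0 < M) :
    ContDiffOn ℝ (⊤ : ℕ∞) (remainderR M) (Ioi (2 * M)) := by
  have h0 := Ioi_subset_compl_zero hM
  exact ((contDiffOn_const.mul (contDiffOn_const.sub (contDiffOn_const.div contDiffOn_id
    fun r hr => h0 hr))).div (contDiffOn_id.pow 2) fun r hr => pow_ne_zero 2 (h0 hr)).neg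

lemma contDiffOn_remainderZ (hM : 0 < M) (s : ℕ) :
    ContDiffOn ℝ (⊤ : ℕ∞) (remainderZ M s) (Ioi (2 * M)) := by
  have h0 := Ioi_subset_compl_zero hM
  exact (((contDiffOn_Dc.mono h0).mul contDiffOn_const).mul contDiffOn_const).div
    (contDiffOn_id.pow 3) fun r hr => pow_ne_zero 3 (h0 hr)

lemma contDiffOn_remainderT (hM : 0 < M) :
    ContDiffOn ℝ (⊤ : ℕ∞) (remainderT M) (Ioi (2 * M)) := by
  have h0 := Ioi_subset_compl_zero hM
  have hpos : ∀ r ∈ Ioi (2 * M), 0 < 1 + 6 * M / r := fun r hr =>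
    one_add_pos hM (by have : 2 * M < r := hr; linarith)
  have hdiv : ∀ c : ℝ, ContDiffOn ℝ (⊤ : ℕ∞) (fun r : ℝ => c / r) (Ioi (2 * M)) := fun c =>
    contDiffOn_const.div contDiffOn_id fun r hr => h0 hr
  have hw : ContDiffOn ℝ (⊤ : ℕ∞) (fun r => (Real.sqrt (1 + 6 * M / r))⁻¹) (Ioi (2 * M)) :=
    ((contDiffOn_const.add (hdiv _)).sqrt fun r hr => (hpos r hr).ne').inv
      fun r hr => (Real.sqrt_pos.2 (hpos r hr)).ne'
  exact (contDiffOn_const.div (contDiffOn_id.pow 2) fun r hr => pow_ne_zero 2 (h0 hr)).mul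
    ((((hw.sub (contDiffOn_const.mul ((hdiv M).pow 2))).div (contDiffOn_Dc.mono h0)
      fun r hr => (Dc_pos hM hr).ne').sub (contDiffOn_const.mul (hw.pow 3))).sub
        (contDiffOn_const.mul (hdiv M)))

lemma div_mem_Ioo (hM : 0 < M) (hr : 2 * M < r) : 0 < M / r ∧ M / r < 1 / 2 := by
  have h0 : 0 < r := by linarith
  refine ⟨by positivity, ?_⟩
  rw [div_lt_iff₀ h0]
  linarith

lemma abs_remainderR_le (hM : 0 < M) (hr : 2 * M < r) : r ^ 2 * |remainderR M r| ≤ 2 * M := by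
  have h0 : 0 < r := by linarith
  obtain ⟨hx0, hx1⟩ := div_mem_Ioo hM hr
  have h : remainderR M r = -(M * (2 - 3 * (M / r)) / r ^ 2) := by rw [remainderR, mul_div_assoc 3]
  rw [h, abs_neg, abs_of_nonneg (div_nonneg (mul_nonneg hM.le (by linarith)) (by positivity)),
    mul_div_cancel₀ _ (by positivity)]
  nlinarith

lemma abs_remainderZ_le (hM : 0 < M) (hr : 2 * M < r) {s : ℕ} (hs : s ≤ 2) :
    r ^ 3 * |remainderZ M s r| ≤ 6 * M := by
  have h0 : 0 < r := by linarith
  obtain ⟨hx0, hx1⟩ := div_mem_Ioo hM hr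
  have hD := Dc_pos hM hr
  have hD1 : Dc M r ≤ 1 := by rw [Dc, mul_div_assoc]; linarith
  have hs' : |1 - (s : ℝ) ^ 2| ≤ 3 := by
    interval_cases s <;> norm_num
  rw [remainderZ, abs_div, abs_of_pos (pow_pos h0 3), mul_div_cancel₀ _ (by positivity), abs_mul,
    abs_mul, abs_of_pos hD, abs_of_pos (by positivity : 0 < 2 * M)]
  have : Dc M r * |1 - (s : ℝ) ^ 2| ≤ 1 * 3 := mul_le_mul hD1 hs' (abs_nonneg _) zero_le_one
  nlinarith

/-- The apparent singularity of `remainderT` at the horizon is removable. -/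
lemma abs_wFluxT_quotient_le (hM : 0 < M) (hr : 2 * M < r) :
    |((Real.sqrt (1 + 6 * M / r))⁻¹ - 2 * (M / r) ^ 2) / Dc M r| ≤ 10 := by
  have h0 : 0 < r := by linarith
  obtain ⟨hx0, hx1⟩ := div_mem_Ioo hM hr
  have hw := Real.sqrt_pos.2 (one_add_pos hM h0)
  have hww := Real.sq_sqrt (one_add_pos hM h0).le
  generalize Real.sqrt (1 + 6 * M / r) = w at *
  rw [Dc]
  rw [mul_div_assoc] at hww ⊢
  generalize M / r = x at *
  have hw2 : w < 2 := by nlinarith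
  have hw1 : 1 / 2 < w⁻¹ := by
    rw [one_div]; exact inv_strictAnti₀ hw hw2
  have hden : 0 < w⁻¹ + 2 * x ^ 2 := by positivity
  have key : (w⁻¹ - 2 * x ^ 2) / (1 - 2 * x) =
      (1 + 2 * x + 4 * x ^ 2 + 8 * x ^ 3 + 12 * x ^ 4) / ((1 + 6 * x) * (w⁻¹ + 2 * x ^ 2)) := by
    have hi : w⁻¹ ^ 2 * (1 + 6 * x) = 1 := by rw [← hww]; field_simp
    rw [div_eq_div_iff (by linarith) (by positivity)]
    linear_combination hi
  rw [key, abs_of_pos (by positivity), div_le_iff₀ (by positivity)]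
  have h2 : x ^ 2 ≤ x / 2 := by nlinarith
  have h3 : x ^ 3 ≤ x / 4 := by nlinarith
  have h4 : x ^ 4 ≤ x / 8 := by nlinarith
  nlinarith

lemma abs_remainderT_le (hM : 0 < M) (hr : 2 * M < r) : r ^ 2 * |remainderT M r| ≤ 15 * M := by
  have h0 : 0 < r := by linarith
  obtain ⟨hx0, hx1⟩ := div_mem_Ioo hM hr
  have hq := abs_le.1 (abs_wFluxT_quotient_le hM hr)
  have hw1 : 1 ≤ Real.sqrt (1 + 6 * M / r) := by
    rw [Real.one_le_sqrt, mul_div_assoc]; linarith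
  have hw0 : 0 < (Real.sqrt (1 + 6 * M / r))⁻¹ := by positivity
  have hw3 : (Real.sqrt (1 + 6 * M / r))⁻¹ ^ 3 ≤ 1 := pow_le_one₀ hw0.le (inv_le_one_of_one_le₀ hw1)
  have hw3' := pow_pos hw0 3
  rw [remainderT, abs_mul, abs_of_pos (by positivity : 0 < M / r ^ 2), ← mul_assoc,
    mul_div_cancel₀ _ (by positivity), mul_comm (15 : ℝ)]
  refine mul_le_mul_of_nonneg_left (abs_le.2 ⟨?_, ?_⟩) hM.le <;> linarith [hq.1, hq.2]

end Coefficients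

section Commutation

variable {M : ℝ} {s ℓ : ℕ} {ψ : ℝ → ℝ → ℝ}

/-- `r² P` with its derivatives expanded. -/
def expandedP (M : ℝ) (s ℓ : ℕ) (ψ : ℝ → ℝ → ℝ) : ℝ → ℝ → ℝ := fun t r =>
  (r ^ 2 + 2 * M * r) * pt (pt ψ) t r - 4 * M * r * pt (pr ψ) t r + 2 * M * pt ψ t r
    - 2 * M * pr ψ t r - (r ^ 2 - 2 * M * r) * pr (pr ψ) t r
    + (ℓ * (ℓ + 1) + (1 - (s : ℝ) ^ 2) * (2 * M) / r) * ψ t r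

lemma Pc_eq (hM : 0 < M) (hψ : SmoothOnRegion ψ (Ioi (2 * M))) {r : ℝ} (hr : 2 * M < r) (t : ℝ) :
    r ^ 2 * Pc M s ℓ ψ t r =
      expandedP M s ℓ ψ t r := by
  have h0 : 0 < r := by linarith
  have h := ((hasDerivAt_Dc (M := M) h0).mul (hψ.partial_r.hasDerivAt_pr (t := t) hr)).deriv
  have h' : pr (fun t' r' => Dc M r' * pr ψ t' r') t r =
    2 * M / r ^ 2 * pr ψ t r + Dc M r * pr (pr ψ) t r := h
  rw [expandedP, Pc, h', Dc]
  field_simp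
  ring

/-- The commutation formula for `P` and `W`, valid for every smooth function. -/
lemma Pc_Wc (hM : 0 < M) (hψ : SmoothOnRegion ψ (Ioi (2 * M))) {r : ℝ} (hr : 2 * M < r) (t : ℝ) :
    Pc M s ℓ (Wc M ψ) t r =
      -(2 / r) * (Real.sqrt (1 + 6 * M / r))⁻¹ * (Dc M r)⁻¹ * pt (Wc M ψ) t r
        + (r ^ 2)⁻¹ * Wc M (fun t' r' => r' ^ 2 * Pc M s ℓ ψ t' r') t r
        + (Real.sqrt (Dc M r))⁻¹ *
          (remainderR M r * pr ψ t r + remainderT M r * pt ψ t r + remainderZ M s r * ψ t r) := by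
  have h0 : 0 < r := by linarith
  have hD := Dc_pos hM hr
  have hψt := hψ.partial_t
  have hψr := hψ.partial_r
  have hψtt := hψt.partial_t
  have hψtr := hψr.partial_t
  have hψrr := hψr.partial_r
  have hprtt : pr (pt (pt ψ)) t r = pt (pt (pr ψ)) t r :=
    (hψt.pr_pt hr).trans (pt_congr fun _ => hψ.pr_pt hr)
  have hprtr : pr (pt (pr ψ)) t r = pt (pr (pr ψ)) t r := hψr.pr_pt hr
  have pt_W : ∀ t, pt (Wc M ψ) t r =
      wCoeffT M r * pt (pt ψ) t r + wCoeffR M r * pt (pr ψ) t r := fun t => by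
    rw [pt_congr (v := fun t r => wCoeffT M r * pt ψ t r + wCoeffR M r * pr ψ t r)
      fun t => Wc_eq hM hr ψ t]
    exact (((hψt.hasDerivAt_pt hr).const_mul _).add ((hψr.hasDerivAt_pt hr).const_mul _)).deriv
  have pr_W : ∀ t r, 2 * M < r → pr (Wc M ψ) t r =
      wFluxT M r / Dc M r * pt ψ t r + wCoeffT M r * pt (pr ψ) t r
        + (wFluxR M r / Dc M r * pr ψ t r + wCoeffR M r * pr (pr ψ) t r) := fun t r hr => by
    rw [pr_congr (v := fun t r => wCoeffT M r * pt ψ t r + wCoeffR M r * pr ψ t r)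
      (fun r hr => Wc_eq hM hr ψ t) hr, ← hψ.pr_pt hr]
    exact (((hasDerivAt_wCoeffT hM hr).mul (hψt.hasDerivAt_pr hr)).add
      ((hasDerivAt_wCoeffR hM hr).mul (hψr.hasDerivAt_pr hr))).deriv
  have pt_pt_W : pt (pt (Wc M ψ)) t r =
      wCoeffT M r * pt (pt (pt ψ)) t r + wCoeffR M r * pt (pt (pr ψ)) t r := by
    rw [pt_congr (v := fun t r => wCoeffT M r * pt (pt ψ) t r + wCoeffR M r * pt (pr ψ) t r) pt_W]
    exact (((hψtt.hasDerivAt_pt hr).const_mul _).add ((hψtr.hasDerivAt_pt hr).const_mul _)).deriv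
  have pt_pr_W : pt (pr (Wc M ψ)) t r =
      wFluxT M r / Dc M r * pt (pt ψ) t r + wCoeffT M r * pt (pt (pr ψ)) t r
        + (wFluxR M r / Dc M r * pt (pr ψ) t r + wCoeffR M r * pt (pr (pr ψ)) t r) := by
    rw [pt_congr (v := fun t r => wFluxT M r / Dc M r * pt ψ t r + wCoeffT M r * pt (pr ψ) t r
        + (wFluxR M r / Dc M r * pr ψ t r + wCoeffR M r * pr (pr ψ) t r)) fun t => pr_W t r hr]
    exact ((((hψt.hasDerivAt_pt hr).const_mul _).add ((hψtr.hasDerivAt_pt hr).const_mul _)).add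
      (((hψr.hasDerivAt_pt hr).const_mul _).add ((hψrr.hasDerivAt_pt hr).const_mul _))).deriv
  have pr_flux : pr (fun t r => Dc M r * pr (Wc M ψ) t r) t r =
      -((Real.sqrt (Dc M r))⁻¹ * remainderT M r) * pt ψ t r + wFluxT M r * pt (pr ψ) t r
        + ((2 * M / r ^ 2 * wCoeffT M r + Dc M r * (wFluxT M r / Dc M r)) * pt (pr ψ) t r
          + Dc M r * wCoeffT M r * pt (pr (pr ψ)) t r)
        + (-((Real.sqrt (Dc M r))⁻¹ * remainderR M r) * pr ψ t r + wFluxR M r * pr (pr ψ) t r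
        + ((2 * M / r ^ 2 * wCoeffR M r + Dc M r * (wFluxR M r / Dc M r)) * pr (pr ψ) t r
          + Dc M r * wCoeffR M r * pr (pr (pr ψ)) t r)) := by
    rw [pr_congr (v := fun t r => wFluxT M r * pt ψ t r + Dc M r * wCoeffT M r * pt (pr ψ) t r
        + (wFluxR M r * pr ψ t r + Dc M r * wCoeffR M r * pr (pr ψ) t r))
      (fun r hr => by
        have := (Dc_pos hM hr).ne'
        rw [pr_W t r hr]
        field_simp) hr]
    have hDα := (hasDerivAt_Dc (M := M) h0).mul (hasDerivAt_wCoeffT hM hr)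
    have hDb := (hasDerivAt_Dc (M := M) h0).mul (hasDerivAt_wCoeffR hM hr)
    refine ((((hasDerivAt_wFluxT hM hr).mul (hψt.hasDerivAt_pr hr)).add
      (hDα.mul (hψtr.hasDerivAt_pr hr))).add (((hasDerivAt_wFluxR hM hr).mul
        (hψr.hasDerivAt_pr hr)).add (hDb.mul (hψrr.hasDerivAt_pr hr)))).deriv.trans ?_
    rw [hψ.pr_pt hr, hprtr]
    rfl
  have pt_P : pt (fun t r => r ^ 2 * Pc M s ℓ ψ t r) t r =
      (r ^ 2 + 2 * M * r) * pt (pt (pt ψ)) t r - 4 * M * r * pt (pt (pr ψ)) t r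
        + 2 * M * pt (pt ψ) t r - 2 * M * pt (pr ψ) t r
        - (r ^ 2 - 2 * M * r) * pt (pr (pr ψ)) t r
        + (ℓ * (ℓ + 1) + (1 - (s : ℝ) ^ 2) * (2 * M) / r) * pt ψ t r := by
    rw [pt_congr (v := expandedP M s ℓ ψ) fun t => Pc_eq hM hψ hr t]
    exact ((((((hψtt.hasDerivAt_pt hr).const_mul _).sub ((hψtr.hasDerivAt_pt hr).const_mul _)).add
      ((hψt.hasDerivAt_pt hr).const_mul _)).sub ((hψr.hasDerivAt_pt hr).const_mul _)).sub
      ((hψrr.hasDerivAt_pt hr).const_mul _)).add ((hψ.hasDerivAt_pt hr).const_mul _) |>.deriv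
  have pr_P : pr (fun t r => r ^ 2 * Pc M s ℓ ψ t r) t r =
      (2 * r + 2 * M) * pt (pt ψ) t r + (r ^ 2 + 2 * M * r) * pt (pt (pr ψ)) t r
        - (4 * M * pt (pr ψ) t r + 4 * M * r * pt (pr (pr ψ)) t r)
        + 2 * M * pt (pr ψ) t r - 2 * M * pr (pr ψ) t r
        - ((2 * r - 2 * M) * pr (pr ψ) t r + (r ^ 2 - 2 * M * r) * pr (pr (pr ψ)) t r)
        + (-((1 - (s : ℝ) ^ 2) * (2 * M) / r ^ 2) * ψ t r
          + (ℓ * (ℓ + 1) + (1 - (s : ℝ) ^ 2) * (2 * M) / r) * pr ψ t r) := by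
    rw [pr_congr (v := expandedP M s ℓ ψ) (fun r hr => Pc_eq hM hψ hr t) hr]
    have hsq : HasDerivAt (fun r : ℝ => r ^ 2) (2 * r) r := by simpa using hasDerivAt_pow 2 r
    have hlin : ∀ c : ℝ, HasDerivAt (fun r : ℝ => c * r) c r := fun c => by
      simpa using (hasDerivAt_id r).const_mul c
    have hpot : ∀ c d : ℝ, HasDerivAt (fun r : ℝ => c + d / r) (-d / r ^ 2) r := fun c d => by
      simpa using ((hasDerivAt_const r d).div (hasDerivAt_id r) h0.ne').const_add c
    refine (((((((hsq.add (hlin (2 * M))).mul (hψtt.hasDerivAt_pr hr)).sub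
      ((hlin (4 * M)).mul (hψtr.hasDerivAt_pr hr))).add ((hψt.hasDerivAt_pr hr).const_mul _)).sub
      ((hψr.hasDerivAt_pr hr).const_mul _)).sub
      ((hsq.sub (hlin (2 * M))).mul (hψrr.hasDerivAt_pr hr))).add
      ((hpot _ _).mul (hψ.hasDerivAt_pr hr))).deriv.trans ?_
    rw [hψ.pr_pt hr, hprtt, hprtr]
    simp only [Pi.add_apply, Pi.sub_apply]
    ring
  rw [Wc_eq hM hr (fun t' r' => r' ^ 2 * Pc M s ℓ ψ t' r'), pt_P, pr_P, Pc, pt_pt_W, pt_pr_W,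
    pr_flux, pt_W, Wc_eq hM hr ψ]
  have hflux : ∀ c, Dc M r * (c / Dc M r) = c := fun c => mul_div_cancel₀ c hD.ne'
  have hZ : (Real.sqrt (Dc M r))⁻¹ * remainderZ M s r =
      wCoeffR M r / r ^ 2 * ((1 - (s : ℝ) ^ 2) * (2 * M) / r ^ 2) := by
    have hg := Real.sqrt_pos.2 hD
    rw [remainderZ, wCoeffR, (sqrt_relations hM hr).2.2, Real.sqrt_sq hg.le]
    field_simp
  have hDr : Dc M r = 1 - 2 * M / r := rfl
  linear_combination (norm := (ring_nf; field_simp; ring)) pt (pt ψ) t r * commutator_coeff_tt hM hr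
    + pt (pr ψ) t r * commutator_coeff_tr hM hr + pr (pr ψ) t r * commutator_coeff_rr hM hr
    - hZ * ψ t r - hflux (wFluxT M r) * pt (pr ψ) t r - hflux (wFluxR M r) * pr (pr ψ) t r
    - (2 / r * wCoeffR M r * pr (pr ψ) t r + wCoeffT M r * pt (pr (pr ψ)) t r
      + wCoeffR M r * pr (pr (pr ψ)) t r) * hDr

end Commutation

/-- **Eqs. (9)–(10): mode-reduced commutation identity for `W`.** -/
theorem commutation_identity (M C : ℝ) (hM : 0 < M) (hC : 0 < C) (s : ℕ) (hs : s ≤ 2) :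
    ∃ Chat : ℝ, 0 < Chat ∧ ∃ h₁ h₂ h₃ : ℝ → ℝ,
      ContDiffOn ℝ (⊤ : ℕ∞) h₁ (Ioi (2*M)) ∧ ContDiffOn ℝ (⊤ : ℕ∞) h₂ (Ioi (2*M)) ∧
      ContDiffOn ℝ (⊤ : ℕ∞) h₃ (Ioi (2*M)) ∧
      (∀ r : ℝ, 2*M < r → r^2 * |h₁ r| + r^2 * |h₂ r| + r^3 * |h₃ r| ≤ Chat) ∧
      ∀ (ℓ : ℕ), s ≤ ℓ →
      ∀ ε : ℝ, 0 ≤ ε →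
      ∀ βt βr ψ : ℝ → ℝ → ℝ,
        SmoothOnRegion βt (Ioi (2*M)) → SmoothOnRegion βr (Ioi (2*M)) →
        BetaBounds M C βt βr →
        SmoothOnRegion ψ (Ioi (2*M)) →
        SolvesPerturbedRW M s ℓ ε βt βr ψ →
        ∀ t r : ℝ, 2*M < r →
          Pc M s ℓ (Wc M ψ) t r =
            -(2/r) * (Real.sqrt (1 + 6*M/r))⁻¹ * (Dc M r)⁻¹ * pt (Wc M ψ) t r
              + ε * (r^2)⁻¹ *
                  Wc M (fun t' r' => r'^2 * (βt t' r' * pt ψ t' r' + βr t' r' * pr ψ t' r')) t r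
              + (Real.sqrt (Dc M r))⁻¹ *
                  (h₁ r * pr ψ t r + h₂ r * pt ψ t r + h₃ r * ψ t r) := by
  refine ⟨23 * M, by positivity, remainderR M, remainderT M, remainderZ M s,
    contDiffOn_remainderR hM, contDiffOn_remainderT hM, contDiffOn_remainderZ hM s,
    fun r hr => ?_, ?_⟩
  · linarith [abs_remainderR_le hM hr, abs_remainderT_le hM hr, abs_remainderZ_le hM hr hs]
  intro ℓ _ ε _ βt βr ψ _ _ _ hψ hsol t r hr
  have hsrc : Wc M (fun t' r' => r' ^ 2 * Pc M s ℓ ψ t' r') t r =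
      ε * Wc M (fun t' r' => r' ^ 2 * (βt t' r' * pt ψ t' r' + βr t' r' * pr ψ t' r')) t r := by
    have heq : ∀ t r, 2 * M < r → r ^ 2 * Pc M s ℓ ψ t r =
        ε * (r ^ 2 * (βt t r * pt ψ t r + βr t r * pr ψ t r)) := fun t r hr => by
      rw [hsol t r hr]; ring
    have ht := (pt_congr (t := t) (u := fun t' r' => r' ^ 2 * Pc M s ℓ ψ t' r')
      (v := fun t r => ε * (r ^ 2 * (βt t r * pt ψ t r + βr t r * pr ψ t r)))
      fun t => heq t r hr).trans (deriv_const_mul_field ε)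
    have hr' := (pr_congr (t := t) (u := fun t' r' => r' ^ 2 * Pc M s ℓ ψ t' r')
      (v := fun t r => ε * (r ^ 2 * (βt t r * pt ψ t r + βr t r * pr ψ t r)))
      (fun r hr => heq t r hr) hr).trans (deriv_const_mul_field ε)
    rw [Wc_eq hM hr, Wc_eq hM hr, ht, hr']
    simp only [pt, pr]
    ring
  rw [Pc_Wc hM hψ hr, hsrc]
  ring
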